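/- Let p₀,…,p_m be real polynomials in n variables of total degree at most 2d, and for i = 0,…,m let T_i be a symmetric tensor of dimension n+1 and order 2d representing p_i; let T_e be a symmetric tensor with ⟨T_e, M_{2d}(y)⟩ = (y₀)^{2d} for all y ∈ ℝ^{n+1}, and for k = 1,…,n let T_{−x_k} be a symmetric tensor with ⟨T_{−x_k}, M_{2d}(y)⟩ = −(y₀)^{2d−1} y_k for all y ∈ ℝ^{n+1}. Define in the extended reals: z₊ := inf {p₀(x) : x ∈ ℝⁿ, x ≥ 0, p_i(x) ≤ 0 for i = 1,…,m}; z_{SP,+} := inf {⟨T₀, X⟩ : X ∈ convexHull{M_{2d}(y) : y ∈ ℝ^{n+1}}, ⟨T_i, X⟩ ≤ 0 for i = 1,…,m, ⟨T_{−x_k}, X⟩ ≤ 0 for k = 1,…,n, ⟨T_e, X⟩ = 1}; z_{SD,+} := sup {μ ∈ ℝ : ∃ u ∈ ℝᵐ, u ≥ 0, ∃ v ∈ ℝⁿ, v ≥ 0, such that ⟨T₀, M_{2d}(y)⟩ + ∑_{i=1}^m u_i ⟨T_i, M_{2d}(y)⟩ − ∑_{k=1}^n v_k (y₀)^{2d−1}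 y_k − μ (y₀)^{2d} ≥ 0 for all y ∈ ℝ^{n+1}}; z_{LD,+} := sup_{u ∈ ℝᵐ, u ≥ 0, v ∈ ℝⁿ, v ≥ 0} inf_{x ∈ ℝⁿ} (p₀(x) + ∑_{i=1}^m u_i p_i(x) − ∑_{k=1}^n v_k x_k). Then z_{LD,+} = z_{SD,+} and z_{SD,+} ≤ z_{SP,+} ≤ z₊. -/

import Mathlib

/-- A tensor of dimension `n` and order `d` is symmetric if its entries are invariant under
permutations of its indices. -/
def IsSymmTensor {n d : ℕ} (T : (Fin d → Fin n) → ℝ) : Prop :=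
  ∀ (σ : Equiv.Perm (Fin d)) (f : Fin d → Fin n), T (f ∘ σ) = T f

/-- The tensor inner product `⟨S, T⟩ = ∑ f, S f * T f`. -/
noncomputable def tenIP {n d : ℕ} (S T : (Fin d → Fin n) → ℝ) : ℝ :=
  ∑ f : Fin d → Fin n, S f * T f

/-- `M_d(x)`, the symmetric tensor with entries `M_d(x)(f) = ∏ j, x (f j)`. -/
def tenM (n d : ℕ) (x : Fin n → ℝ) : (Fin d → Fin n) → ℝ := fun f => ∏ j : Fin d, x (f j)

/-- The degree-`d` homogenization of a polynomial `p` in the variables `x₁, …, x_n`: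
`p^h = ∑_α p_α · x₀^(d - |α|) · x^α`, a polynomial in the `n + 1` variables
`(x₀, x₁, …, x_n)` (variable `0` is the homogenizing variable, variable `i.succ` is `x_i`). -/
noncomputable def homogenize {n : ℕ} (d : ℕ) (p : MvPolynomial (Fin n) ℝ) :
    MvPolynomial (Fin (n + 1)) ℝ :=
  ∑ α ∈ p.support,
    MvPolynomial.C (MvPolynomial.coeff α p) *
      MvPolynomial.X (0 : Fin (n + 1)) ^ (d - ∑ i, α i) *
      ∏ i : Fin n, MvPolynomial.X i.succ ^ α i

/-- A symmetric tensor `T` of dimension `n + 1` and order `d` represents the polynomial `p`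
(of total degree at most `d`) if `⟨T, M_d(y)⟩ = p^h(y)` for all `y ∈ ℝ^(n+1)`. -/
def Represents {n : ℕ} (d : ℕ) (T : (Fin d → Fin (n + 1)) → ℝ)
    (p : MvPolynomial (Fin n) ℝ) : Prop :=
  ∀ y : Fin (n + 1) → ℝ,
    tenIP T (tenM (n + 1) d y) = MvPolynomial.eval y (homogenize d p)

theorem tenIP_eq_dotProduct {n d : ℕ} (S T : (Fin d → Fin n) → ℝ) : tenIP S T = S ⬝ᵥ T := rfl

theorem tenM_smul {n d : ℕ} (c : ℝ) (y : Fin n → ℝ) :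
    tenM n d (c • y) = c ^ d • tenM n d y := by
  funext f
  simp [tenM, Finset.prod_mul_distrib]

theorem tenIP_tenM_smul {n d : ℕ} (W : (Fin d → Fin n) → ℝ) (c : ℝ) (y : Fin n → ℝ) :
    tenIP W (tenM n d (c • y)) = c ^ d * tenIP W (tenM n d y) := by
  simp [tenM_smul, tenIP_eq_dotProduct]

theorem continuous_tenIP_tenM {n d : ℕ} (W : (Fin d → Fin n) → ℝ) :
    Continuous fun y : Fin n → ℝ => tenIP W (tenM n d y) := by
  unfold tenIP tenM
  fun_prop

/-- A tensor of even order whose form is nonnegative on the affine chart `y₀ = 1` is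
nonnegative everywhere. -/
theorem tenIP_tenM_nonneg_of_cons_one {n d : ℕ} (W : (Fin (2 * d) → Fin (n + 1)) → ℝ)
    (h : ∀ x : Fin n → ℝ, 0 ≤ tenIP W (tenM (n + 1) (2 * d) (Fin.cons 1 x)))
    (y : Fin (n + 1) → ℝ) : 0 ≤ tenIP W (tenM (n + 1) (2 * d) y) := by
  have key (t : ℝ) (ht : t ≠ 0) (x : Fin n → ℝ) :
      0 ≤ tenIP W (tenM (n + 1) (2 * d) (Fin.cons t x)) := by
    have e : (Fin.cons t x : Fin (n + 1) → ℝ) = t • Fin.cons 1 (t⁻¹ • x) := by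
      funext i
      refine Fin.cases ?_ (fun j => ?_) i <;> simp [ht]
    rw [e, tenIP_tenM_smul]
    exact mul_nonneg ((even_two_mul d).pow_nonneg t) (h _)
  have hcont : Continuous fun t : ℝ =>
      tenIP W (tenM (n + 1) (2 * d) (Fin.cons t (Fin.tail y) : Fin (n + 1) → ℝ)) :=
    (continuous_tenIP_tenM W).comp (Continuous.finCons (A := fun _ => ℝ) continuous_id continuous_const)
  have hclosed := isClosed_Ici.preimage hcont (t := Set.Ici (0 : ℝ))
  have huniv := (dense_compl_singleton (0 : ℝ)).closure_eq ▸
    hclosed.closure_subset_iff.2 fun t ht => key t ht (Fin.tail y)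
  simpa using huniv (Set.mem_univ (y 0))

theorem eval_cons_one_homogenize {n d : ℕ} (p : MvPolynomial (Fin n) ℝ) (x : Fin n → ℝ) :
    MvPolynomial.eval (Fin.cons 1 x) (homogenize d p) = MvPolynomial.eval x p := by
  rw [MvPolynomial.eval_eq' x p]
  simp [homogenize]

theorem tenIP_nonneg_of_mem_convexHull {n d : ℕ} {W X : (Fin d → Fin n) → ℝ}
    (hW : ∀ y, 0 ≤ tenIP W (tenM n d y))
    (hX : X ∈ convexHull ℝ {S : (Fin d → Fin n) → ℝ | ∃ y : Fin n → ℝ, S = tenM n d y}) :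
    0 ≤ tenIP W X := by
  refine convexHull_min (t := {X | 0 ≤ tenIP W X}) ?_ ?_ hX
  · rintro _ ⟨y, rfl⟩
    exact hW y
  · exact convex_halfSpace_ge (dotProductBilin ℝ ℝ W).isLinear 0

/-- with `z₊`, `z_{SP,+}`, `z_{SD,+}`, `z_{LD,+}` as in the CPSD tensor
relaxation (with explicit nonnegativity constraints) of a POP with nonnegative variables,
`z_{LD,+} = z_{SD,+}` and `z_{SD,+} ≤ z_{SP,+} ≤ z₊` in the extended reals. -/
theorem lagrangian_eq_cpsd_plus_dual_le_cpsd_plus_le_pop (n d m : ℕ)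
    (p : Fin (m + 1) → MvPolynomial (Fin n) ℝ)
    (hdeg : ∀ i, (p i).totalDegree ≤ 2 * d)
    (T : Fin (m + 1) → (Fin (2 * d) → Fin (n + 1)) → ℝ)
    (hTsymm : ∀ i, IsSymmTensor (T i))
    (hTrep : ∀ i, Represents (2 * d) (T i) (p i))
    (Te : (Fin (2 * d) → Fin (n + 1)) → ℝ)
    (hTesymm : IsSymmTensor Te)
    (hTerep : ∀ y : Fin (n + 1) → ℝ, tenIP Te (tenM (n + 1) (2 * d) y) = (y 0) ^ (2 * d))
    (Tm : Fin n → (Fin (2 * d) → Fin (n + 1)) → ℝ)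
    (hTmsymm : ∀ k, IsSymmTensor (Tm k))
    (hTmrep : ∀ (k : Fin n) (y : Fin (n + 1) → ℝ),
      tenIP (Tm k) (tenM (n + 1) (2 * d) y) = -((y 0) ^ (2 * d - 1) * y k.succ))
    (zP zSPP zSDP zLDP : EReal)
    (hzP : zP = sInf {w : EReal | ∃ x : Fin n → ℝ, (∀ j, 0 ≤ x j) ∧
      (∀ i : Fin m, MvPolynomial.eval x (p i.succ) ≤ 0) ∧
      w = ((MvPolynomial.eval x (p 0) : ℝ) : EReal)})
    (hzSPP : zSPP = sInf {w : EReal | ∃ X : (Fin (2 * d) → Fin (n + 1)) → ℝ,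
      X ∈ convexHull ℝ {S : (Fin (2 * d) → Fin (n + 1)) → ℝ |
        ∃ y : Fin (n + 1) → ℝ, S = tenM (n + 1) (2 * d) y} ∧
      (∀ i : Fin m, tenIP (T i.succ) X ≤ 0) ∧
      (∀ k : Fin n, tenIP (Tm k) X ≤ 0) ∧
      tenIP Te X = 1 ∧
      w = ((tenIP (T 0) X : ℝ) : EReal)})
    (hzSDP : zSDP = sSup {w : EReal | ∃ μ : ℝ, w = ((μ : ℝ) : EReal) ∧
      ∃ u : Fin m → ℝ, (∀ i, 0 ≤ u i) ∧
        ∃ v : Fin n → ℝ, (∀ k, 0 ≤ v k) ∧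
          ∀ y : Fin (n + 1) → ℝ,
            0 ≤ tenIP (T 0) (tenM (n + 1) (2 * d) y) +
                (∑ i : Fin m, u i * tenIP (T i.succ) (tenM (n + 1) (2 * d) y)) -
                (∑ k : Fin n, v k * ((y 0) ^ (2 * d - 1) * y k.succ)) -
                μ * (y 0) ^ (2 * d)})
    (hzLDP : zLDP = ⨆ (u : Fin m → ℝ) (_ : ∀ i, 0 ≤ u i)
        (v : Fin n → ℝ) (_ : ∀ k, 0 ≤ v k),
      ⨅ (x : Fin n → ℝ),
        ((MvPolynomial.eval x (p 0) +
          (∑ i : Fin m, u i * MvPolynomial.eval x (p i.succ)) -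
          ∑ k : Fin n, v k * x k : ℝ) : EReal)) :
    zLDP = zSDP ∧ zSDP ≤ zSPP ∧ zSPP ≤ zP := by
  have hchart (i : Fin (m + 1)) (x : Fin n → ℝ) :
      tenIP (T i) (tenM (n + 1) (2 * d) (Fin.cons 1 x)) = MvPolynomial.eval x (p i) := by
    rw [hTrep, eval_cons_one_homogenize]
  have hTechart (x : Fin n → ℝ) : tenIP Te (tenM (n + 1) (2 * d) (Fin.cons 1 x)) = 1 := by
    simp [hTerep]
  have hTmchart (k : Fin n) (x : Fin n → ℝ) :
      tenIP (Tm k) (tenM (n + 1) (2 * d) (Fin.cons 1 x)) = -x k := by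
    simp [hTmrep]
  -- The tensor of the Lagrangian with multipliers `u`, `v`, shifted by `μ`.
  let W (u : Fin m → ℝ) (v : Fin n → ℝ) (μ : ℝ) : (Fin (2 * d) → Fin (n + 1)) → ℝ :=
    T 0 + ∑ i, u i • T i.succ + ∑ k, v k • Tm k - μ • Te
  have hW (u v μ X) : tenIP (W u v μ) X = tenIP (T 0) X + ∑ i, u i * tenIP (T i.succ) X +
      ∑ k, v k * tenIP (Tm k) X - μ * tenIP Te X := by
    simp [W, tenIP_eq_dotProduct, add_dotProduct, sub_dotProduct, sum_dotProduct]
  have hWM (u v μ y) : tenIP (W u v μ) (tenM (n + 1) (2 * d) y) =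
      tenIP (T 0) (tenM (n + 1) (2 * d) y) +
        (∑ i : Fin m, u i * tenIP (T i.succ) (tenM (n + 1) (2 * d) y)) -
        (∑ k : Fin n, v k * ((y 0) ^ (2 * d - 1) * y k.succ)) - μ * (y 0) ^ (2 * d) := by
    simp only [hW, hTmrep, hTerep, mul_neg, Finset.sum_neg_distrib]
    ring
  have hWchart (u v μ x) : tenIP (W u v μ) (tenM (n + 1) (2 * d) (Fin.cons 1 x)) =
      MvPolynomial.eval x (p 0) + (∑ i : Fin m, u i * MvPolynomial.eval x (p i.succ)) -
        (∑ k : Fin n, v k * x k) - μ := by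
    simp only [hW, hchart, hTmchart, hTechart, mul_neg, Finset.sum_neg_distrib]
    ring
  simp only [← hWM] at hzSDP
  subst hzP hzSPP hzSDP hzLDP
  refine ⟨le_antisymm ?_ ?_, ?_, ?_⟩
  · refine iSup₂_le fun u hu => iSup₂_le fun v hv => EReal.ge_of_forall_gt_iff_ge.1 fun μ hμ => ?_
    refine le_sSup ⟨μ, rfl, u, hu, v, hv, tenIP_tenM_nonneg_of_cons_one _ fun x => ?_⟩
    rw [hWchart]
    exact sub_nonneg.2 (EReal.coe_le_coe_iff.1 (hμ.le.trans (iInf_le _ x)))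
  · refine sSup_le ?_
    rintro _ ⟨μ, rfl, u, hu, v, hv, h⟩
    refine le_iSup₂_of_le u hu (le_iSup₂_of_le v hv (le_iInf fun x => ?_))
    have hx := h (Fin.cons 1 x)
    rw [hWchart] at hx
    exact EReal.coe_le_coe_iff.2 (sub_nonneg.1 hx)
  · refine sSup_le ?_
    rintro _ ⟨μ, rfl, u, hu, v, hv, h⟩
    refine le_sInf ?_
    rintro _ ⟨X, hX, hTX, hTmX, hTeX, rfl⟩
    have hpos := tenIP_nonneg_of_mem_convexHull h hX
    rw [hW, hTeX] at hpos
    have hsumT : ∑ i, u i * tenIP (T i.succ) X ≤ 0 :=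
      Finset.sum_nonpos fun i _ => mul_nonpos_of_nonneg_of_nonpos (hu i) (hTX i)
    have hsumTm : ∑ k, v k * tenIP (Tm k) X ≤ 0 :=
      Finset.sum_nonpos fun k _ => mul_nonpos_of_nonneg_of_nonpos (hv k) (hTmX k)
    exact EReal.coe_le_coe_iff.2 (by linarith)
  · refine le_sInf ?_
    rintro _ ⟨x, hx, hpx, rfl⟩
    refine sInf_le ⟨tenM (n + 1) (2 * d) (Fin.cons 1 x), subset_convexHull ℝ _ ⟨_, rfl⟩,
      fun i => ?_, fun k => ?_, hTechart x, ?_⟩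
    · exact (hchart _ x).trans_le (hpx i)
    · rw [hTmchart]
      exact neg_nonpos.2 (hx k)
    · rw [hchart]
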